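/- arXiv:2603.25116 — 3 statements merged into one kernel-verified Lean document; each statement's English description precedes it below -/
import Mathlib

section
/- For every real number α with 0 < α < 1/2 and every integer m ≥ 1, the complex-valued integral (1/(2π)) ∫₀^{2π} (2 sin(φ/2))^{−2α} e^{−imφ} dφ equals the real number Γ(1 − 2α) Γ(m + α) / (Γ(α) Γ(1 − α) Γ(m + 1 − α)). -/
open MeasureTheory Set in
lemma aux_image : (fun φ : ℝ => (1 - Real.cos (φ / 2)) / 2) '' Ioo 0 (2 * Real.pi) = Ioo 0 1 := by
  ext x
  simp only [mem_image, mem_Ioo]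
  constructor
  · rintro ⟨φ, ⟨h1, h2⟩, rfl⟩
    have a : Real.cos (φ / 2) < Real.cos 0 :=
      Real.strictAntiOn_cos ⟨le_rfl, Real.pi_pos.le⟩ ⟨by linarith, by linarith⟩ (by linarith)
    have b : Real.cos Real.pi < Real.cos (φ / 2) :=
      Real.strictAntiOn_cos ⟨by linarith, by linarith⟩ ⟨Real.pi_pos.le, le_rfl⟩ (by linarith)
    rw [Real.cos_zero] at a
    rw [Real.cos_pi] at b
    constructor <;> linarith
  · rintro ⟨h1, h2⟩
    refine ⟨2 * Real.arccos (1 - 2 * x), ⟨?_, ?_⟩, ?_⟩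
    · have := Real.arccos_pos.2 (show 1 - 2 * x < 1 by linarith)
      linarith
    · have : Real.arccos (1 - 2 * x) ≠ Real.pi := by
        intro h
        rw [Real.arccos_eq_pi] at h
        linarith
      have := lt_of_le_of_ne (Real.arccos_le_pi (1 - 2 * x)) this
      linarith
    · rw [mul_div_cancel_left₀ _ (by norm_num), Real.cos_arccos (by linarith) (by linarith)]
      ring

open MeasureTheory Set in
lemma aux_inj : InjOn (fun φ : ℝ => (1 - Real.cos (φ / 2)) / 2) (Ioo 0 (2 * Real.pi)) := by
  intro x hx y hy h
  have h' : Real.cos (x / 2) = Real.cos (y / 2) := by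
    simp only at h
    linarith
  have := Real.injOn_cos ⟨by linarith [hx.1], by linarith [hx.2]⟩
    ⟨by linarith [hy.1], by linarith [hy.2]⟩ h'
  linarith

lemma aux_deriv (x : ℝ) : HasDerivAt (fun φ : ℝ => (1 - Real.cos (φ / 2)) / 2)
    (Real.sin (x / 2) / 4) x := by
  have h := ((((hasDerivAt_id x).div_const 2).cos).const_sub 1).div_const 2
  refine h.congr_deriv ?_
  simp only [id]
  ring

lemma aux_sin_pos {x : ℝ} (hx : x ∈ Set.Ioo 0 (2 * Real.pi)) : 0 < Real.sin (x / 2) :=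
  Real.sin_pos_of_pos_of_lt_pi (by linarith [hx.1]) (by linarith [hx.2])

lemma aux_point (α : ℝ) {x : ℝ} (hx : x ∈ Set.Ioo 0 (2 * Real.pi)) :
    |Real.sin (x / 2) / 4| •
      ((((1 - Real.cos (x / 2)) / 2 : ℝ) : ℂ) ^ (((1 / 2 - α : ℝ) : ℂ) - 1) *
        (1 - (((1 - Real.cos (x / 2)) / 2 : ℝ) : ℂ)) ^ (((1 / 2 - α : ℝ) : ℂ) - 1))
      = (((4 : ℝ) ^ (2 * α) / 2 : ℝ) : ℂ) * (((2 * Real.sin (x / 2)) ^ (-(2 * α)) : ℝ) : ℂ) := by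
  have hs := aux_sin_pos hx
  have hc1 : Real.cos (x / 2) ≤ 1 := Real.cos_le_one _
  have hc2 : -1 ≤ Real.cos (x / 2) := Real.neg_one_le_cos _
  have hsq := Real.sin_sq_add_cos_sq (x / 2)
  generalize Real.sin (x / 2) = s at *
  generalize Real.cos (x / 2) = c at *
  have e1 : ((1 / 2 - α : ℝ) : ℂ) - 1 = ((-1 / 2 - α : ℝ) : ℂ) := by push_cast; ring
  have e2 : (1 : ℂ) - (((1 - c) / 2 : ℝ) : ℂ) = (((1 + c) / 2 : ℝ) : ℂ) := by push_cast; ring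
  rw [e1, e2, ← Complex.ofReal_cpow (by linarith), ← Complex.ofReal_cpow (by linarith),
    Complex.real_smul, ← Complex.ofReal_mul, ← Complex.ofReal_mul, ← Complex.ofReal_mul]
  congr 1
  rw [← Real.mul_rpow (by linarith) (by linarith), abs_of_pos (by positivity)]
  have e3 : (1 - c) / 2 * ((1 + c) / 2) = (s / 2) ^ (2 : ℝ) := by
    rw [Real.rpow_two]; linarith
  rw [e3, ← Real.rpow_mul (by positivity), Real.mul_rpow (by norm_num) hs.le,
    Real.div_rpow hs.le (by norm_num)]
  have e4 : (2 : ℝ) * (-1 / 2 - α) = -(2 * α) - 1 := by ring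
  have e5 : (4 : ℝ) ^ (2 * α) = 2 ^ (2 * α) * 2 ^ (2 * α) := by
    rw [← Real.mul_rpow (by norm_num) (by norm_num)]; norm_num
  rw [e4, e5, Real.rpow_sub hs, Real.rpow_sub (by norm_num), Real.rpow_one, Real.rpow_one,
    Real.rpow_neg (by norm_num : (0 : ℝ) ≤ 2)]
  have : (2 : ℝ) ^ (2 * α) ≠ 0 := by positivity
  field_simp
  norm_num

open MeasureTheory Set in
lemma aux_integrable (α : ℝ) (h1 : α < 1 / 2) :
    IntervalIntegrable (fun φ : ℝ => (((2 * Real.sin (φ / 2)) ^ (-(2 * α)) : ℝ) : ℂ))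
      volume 0 (2 * Real.pi) := by
  have hu : 0 < (((1 / 2 - α : ℝ) : ℂ)).re := by rw [Complex.ofReal_re]; linarith
  have hB := Complex.betaIntegral_convergent hu hu
  rw [intervalIntegrable_iff_integrableOn_Ioo_of_le zero_le_one, ← aux_image,
    integrableOn_image_iff_integrableOn_abs_deriv_smul measurableSet_Ioo
      (fun x _ => (aux_deriv x).hasDerivWithinAt) aux_inj] at hB
  rw [intervalIntegrable_iff_integrableOn_Ioo_of_le (by positivity)]
  have h2 := (integrableOn_congr_fun (fun x hx => aux_point α hx) measurableSet_Ioo).1 hB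
  refine (IntegrableOn.congr_fun (h2.const_mul ((((4 : ℝ) ^ (2 * α) / 2 : ℝ) : ℂ)⁻¹)) ?_
    measurableSet_Ioo)
  intro x _
  have : (((4 : ℝ) ^ (2 * α) / 2 : ℝ) : ℂ) ≠ 0 := by
    rw [Complex.ofReal_ne_zero]; positivity
  simp only
  rw [inv_mul_cancel_left₀ this]

open MeasureTheory Set in
lemma aux_zero (α : ℝ) (h1 : α < 1 / 2) :
    ∫ φ in (0:ℝ)..(2 * Real.pi), (((2 * Real.sin (φ / 2)) ^ (-(2 * α)) : ℝ) : ℂ)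
      = ((2 * Real.pi * Real.Gamma (1 - 2 * α) / (Real.Gamma (1 - α)) ^ 2 : ℝ) : ℂ) := by
  have hu : 0 < (((1 / 2 - α : ℝ) : ℂ)).re := by rw [Complex.ofReal_re]; linarith
  have hB := Complex.betaIntegral_eq_Gamma_mul_div _ _ hu hu
  rw [Complex.betaIntegral, intervalIntegral.integral_of_le zero_le_one,
    integral_Ioc_eq_integral_Ioo, ← aux_image,
    integral_image_eq_integral_abs_deriv_smul measurableSet_Ioo
      (fun x _ => (aux_deriv x).hasDerivWithinAt) aux_inj,
    setIntegral_congr_fun measurableSet_Ioo (fun x hx => aux_point α hx),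
    integral_const_mul, ← Complex.ofReal_add, Complex.Gamma_ofReal, Complex.Gamma_ofReal,
    ← Complex.ofReal_mul, ← Complex.ofReal_div] at hB
  rw [intervalIntegral.integral_of_le (by positivity), integral_Ioc_eq_integral_Ioo]
  have hC : (((4 : ℝ) ^ (2 * α) / 2 : ℝ) : ℂ) ≠ 0 := by
    rw [Complex.ofReal_ne_zero]; positivity
  apply mul_left_cancel₀ hC
  rw [hB, ← Complex.ofReal_mul]
  congr 1
  have hd := Real.Gamma_mul_Gamma_add_half (1 / 2 - α)
  rw [show 1 / 2 - α + 1 / 2 = 1 - α by ring, show 2 * (1 / 2 - α) = 1 - 2 * α by ring,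
    show 1 - (1 - 2 * α) = 2 * α by ring] at hd
  rw [show 1 / 2 - α + (1 / 2 - α) = 1 - 2 * α by ring]
  have g1 := (Real.Gamma_pos_of_pos (show 0 < 1 - α by linarith)).ne'
  have g2 := (Real.Gamma_pos_of_pos (show 0 < 1 - 2 * α by linarith)).ne'
  have e5 : (4 : ℝ) ^ (2 * α) = 2 ^ (2 * α) * 2 ^ (2 * α) := by
    rw [← Real.mul_rpow (by norm_num) (by norm_num)]; norm_num
  have hpi := Real.mul_self_sqrt Real.pi_pos.le
  rw [e5]
  generalize Real.Gamma (1 / 2 - α) = G at *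
  field_simp
  have := congrArg (fun t => t ^ 2) hd
  simp only [mul_pow, Real.sq_sqrt Real.pi_pos.le] at this
  linear_combination this

open MeasureTheory Set in
lemma aux_int2 (α : ℝ) (h1 : α < 1 / 2) (n : ℕ) :
    IntervalIntegrable (fun φ : ℝ => (((2 * Real.sin (φ / 2)) ^ (-(2 * α)) : ℝ) : ℂ) *
            Complex.exp (-((n : ℂ) * (φ : ℂ)) * Complex.I))
      volume 0 (2 * Real.pi) :=
  (aux_integrable α h1).mul_continuousOn (by fun_prop)

open MeasureTheory Set in
lemma aux_rec (α : ℝ) (h1 : α < 1 / 2) (n : ℕ) :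
    ((n : ℂ) + 1 - α) * (∫ φ in (0:ℝ)..(2 * Real.pi),
          (((2 * Real.sin (φ / 2)) ^ (-(2 * α)) : ℝ) : ℂ) *
            Complex.exp (-(((n + 1 : ℕ) : ℂ) * (φ : ℂ)) * Complex.I)) =
    ((n : ℂ) + α) * (∫ φ in (0:ℝ)..(2 * Real.pi),
          (((2 * Real.sin (φ / 2)) ^ (-(2 * α)) : ℝ) : ℂ) *
            Complex.exp (-((n : ℂ) * (φ : ℂ)) * Complex.I)) := by
  have key := intervalIntegral.integral_eq_sub_of_hasDerivAt_of_le
    (a := 0) (b := 2 * Real.pi)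
    (f := fun φ : ℝ => (((2 * Real.sin (φ / 2)) ^ (1 - 2 * α) : ℝ) : ℂ) *
            Complex.exp (-(((n : ℂ) + 1 / 2) * (φ : ℂ)) * Complex.I))
    (f' := fun φ : ℝ => ((n : ℂ) + 1 - α) * ((((2 * Real.sin (φ / 2)) ^ (-(2 * α)) : ℝ) : ℂ) *
            Complex.exp (-(((n + 1 : ℕ) : ℂ) * (φ : ℂ)) * Complex.I)) -
        ((n : ℂ) + α) * ((((2 * Real.sin (φ / 2)) ^ (-(2 * α)) : ℝ) : ℂ) *
            Complex.exp (-((n : ℂ) * (φ : ℂ)) * Complex.I)))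
    (by positivity) ?_ ?_
    (((aux_int2 α h1 (n + 1)).const_mul _).sub ((aux_int2 α h1 n).const_mul _))
  · rw [intervalIntegral.integral_sub ((aux_int2 α h1 (n + 1)).const_mul _)
      ((aux_int2 α h1 n).const_mul _), intervalIntegral.integral_const_mul,
      intervalIntegral.integral_const_mul] at key
    rw [← sub_eq_zero, key]
    have hne : 1 - 2 * α ≠ 0 := by linarith
    simp [Real.zero_rpow hne]
  · apply Continuous.continuousOn
    apply Continuous.mul
    · refine Complex.continuous_ofReal.comp ?_
      exact Continuous.rpow_const (by fun_prop) (fun x => Or.inr (by linarith))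
    · fun_prop
  · intro x hx
    have hs := aux_sin_pos hx
    have d1 : HasDerivAt (fun φ : ℝ => 2 * Real.sin (φ / 2)) (Real.cos (x / 2)) x := by
      have h := (((hasDerivAt_id x).div_const 2).sin).const_mul 2
      refine h.congr_deriv ?_
      simp only [id]
      ring
    have d2 := (d1.rpow_const (p := 1 - 2 * α) (Or.inl (by positivity))).ofReal_comp
    have d3 : HasDerivAt (fun φ : ℝ => Complex.exp (-(((n : ℂ) + 1 / 2) * (φ : ℂ)) * Complex.I))
        (Complex.exp (-(((n : ℂ) + 1 / 2) * (x : ℂ)) * Complex.I) *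
          (-((n : ℂ) + 1 / 2) * Complex.I)) x := by
      have h := ((((hasDerivAt_id x).ofReal_comp).const_mul ((n : ℂ) + 1 / 2)).neg.mul_const
        Complex.I).cexp
      refine h.congr_deriv ?_
      simp only [id, Pi.neg_apply]
      push_cast
      ring
    refine (d2.mul d3).congr_deriv ?_
    have p1 : 1 - 2 * α - 1 = -(2 * α) := by ring
    have p2 : (2 * Real.sin (x / 2)) ^ (1 - 2 * α) =
        2 * Real.sin (x / 2) * (2 * Real.sin (x / 2)) ^ (-(2 * α)) := by
      rw [sub_eq_add_neg, Real.rpow_add (by positivity), Real.rpow_one]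
    rw [p1, p2]
    generalize (2 * Real.sin (x / 2)) ^ (-(2 * α)) = r
    push_cast
    have q1 : Complex.exp (-(((n : ℂ) + 1) * (x : ℂ)) * Complex.I) =
        Complex.exp (-(((n : ℂ) + 1 / 2) * (x : ℂ)) * Complex.I) *
          (Complex.cos (x / 2) - Complex.sin (x / 2) * Complex.I) := by
      have e : Complex.cos (x / 2) - Complex.sin (x / 2) * Complex.I =
          Complex.exp (-((x : ℂ) / 2) * Complex.I) := by
        rw [Complex.exp_mul_I, Complex.cos_neg, Complex.sin_neg]
        ring
      rw [e, ← Complex.exp_add]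
      congr 1
      ring
    have q2 : Complex.exp (-((n : ℂ) * (x : ℂ)) * Complex.I) =
        Complex.exp (-(((n : ℂ) + 1 / 2) * (x : ℂ)) * Complex.I) *
          (Complex.cos (x / 2) + Complex.sin (x / 2) * Complex.I) := by
      rw [← Complex.exp_mul_I, ← Complex.exp_add]
      congr 1
      ring
    rw [q1, q2]
    ring

lemma aux_nat (α : ℝ) (h0 : 0 < α) (h1 : α < 1 / 2) (n : ℕ) :
    (∫ φ in (0:ℝ)..(2 * Real.pi),
          (((2 * Real.sin (φ / 2)) ^ (-(2 * α)) : ℝ) : ℂ) *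
            Complex.exp (-((n : ℂ) * (φ : ℂ)) * Complex.I))
      = ((2 * Real.pi * (Real.Gamma (1 - 2 * α) * Real.Gamma ((n : ℝ) + α) /
            (Real.Gamma α * Real.Gamma (1 - α) * Real.Gamma ((n : ℝ) + 1 - α))) : ℝ) : ℂ) := by
  induction n with
  | zero =>
    simp only [Nat.cast_zero, zero_mul, neg_zero, Complex.exp_zero, mul_one, zero_add]
    rw [aux_zero α h1]
    congr 1
    have g1 := (Real.Gamma_pos_of_pos (show 0 < 1 - α by linarith)).ne'
    have g2 := (Real.Gamma_pos_of_pos h0).ne'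
    field_simp
  | succ n ih =>
    have h := aux_rec α h1 n
    rw [ih] at h
    have hn : (0 : ℝ) ≤ n := Nat.cast_nonneg n
    have hp : 0 < (n : ℝ) + 1 - α := by linarith
    have hc : (n : ℂ) + 1 - α = (((n : ℝ) + 1 - α : ℝ) : ℂ) := by push_cast; ring
    have hc' : (n : ℂ) + α = (((n : ℝ) + α : ℝ) : ℂ) := by push_cast; ring
    have hne : (((n : ℝ) + 1 - α : ℝ) : ℂ) ≠ 0 := Complex.ofReal_ne_zero.2 hp.ne'
    rw [hc, hc'] at h
    apply mul_left_cancel₀ hne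
    rw [h, ← Complex.ofReal_mul, ← Complex.ofReal_mul]
    congr 1
    have s1 : Real.Gamma (((n + 1 : ℕ) : ℝ) + α) = (n + α) * Real.Gamma (n + α) := by
      rw [← Real.Gamma_add_one (by positivity)]
      congr 1
      push_cast
      ring
    have s2 : Real.Gamma (((n + 1 : ℕ) : ℝ) + 1 - α) = (n + 1 - α) * Real.Gamma (n + 1 - α) := by
      rw [← Real.Gamma_add_one hp.ne']
      congr 1
      push_cast
      ring
    rw [s1, s2]
    have g1 := (Real.Gamma_pos_of_pos (show 0 < 1 - α by linarith)).ne'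
    have g2 := (Real.Gamma_pos_of_pos h0).ne'
    have g3 := (Real.Gamma_pos_of_pos hp).ne'
    have g4 := hp.ne'
    field_simp

/-- Exact Gamma formula for the Fourier coefficients of the singular kernel:
for `0 < α < 1/2` and integer `m ≥ 1`,
`(1/(2π)) ∫₀^{2π} (2 sin(φ/2))^{-2α} e^{-imφ} dφ
  = Γ(1-2α) Γ(m+α) / (Γ(α) Γ(1-α) Γ(m+1-α))`. -/
theorem stmt1 (α : ℝ) (h0 : 0 < α) (h1 : α < 1 / 2) (m : ℤ) (hm : 1 ≤ m) :
    (1 / (2 * Real.pi) : ℂ) *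
        ∫ φ in (0:ℝ)..(2 * Real.pi),
          (((2 * Real.sin (φ / 2)) ^ (-(2 * α)) : ℝ) : ℂ) *
            Complex.exp (-((m : ℂ) * (φ : ℂ)) * Complex.I)
      = ((Real.Gamma (1 - 2 * α) * Real.Gamma ((m : ℝ) + α) /
            (Real.Gamma α * Real.Gamma (1 - α) * Real.Gamma ((m : ℝ) + 1 - α)) : ℝ) : ℂ) := by
  lift m to ℕ using (by omega)
  have h := aux_nat α h0 h1 m
  simp only [Int.cast_natCast]
  rw [h, Complex.ofReal_mul]
  have : (Real.pi : ℂ) ≠ 0 := Complex.ofReal_ne_zero.2 Real.pi_ne_zero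
  push_cast
  field_simp
end

section
/- The series ∑_{m=1}^∞ H_{m−1}² / m³ converges and equals ζ(2) ζ(3) − (3/2) ζ(5). -/
/-- `ζ(s) = ∑_{n≥1} n^{-s}` for real `s`. -/
noncomputable def zetaR (s : ℝ) : ℝ := ∑' n : ℕ, 1 / ((n : ℝ) + 1) ^ s

/-- `H_M = ∑_{k=1}^M 1/k`, with `H_0 = 0`. -/
noncomputable def harmonicR (M : ℕ) : ℝ := ∑ k ∈ Finset.range M, 1 / ((k : ℝ) + 1)

open Filter Topology Finset

namespace EulerAux

theorem hs {β : Type} {f g : β → ℝ} {a b : ℝ} (h : HasSum f a) (hfg : ∀ n, g n = f n)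
    (hab : b = a) : HasSum g b := by
  have : g = f := funext hfg
  rw [this, hab]
  exact h

theorem abel_hasSum (w u : ℕ → ℝ) (S : ℝ) (hw : ∀ k, 0 ≤ w k) (hu : Antitone u)
    (hu0 : Tendsto u atTop (𝓝 0)) (h : HasSum (fun k => w k * u (k + 1)) S) :
    HasSum (fun n => (∑ k ∈ range n, w k) * (u n - u (n + 1))) S := by
  have hupos : ∀ n, 0 ≤ u n := fun n => hu.le_of_tendsto hu0 n
  have hD : ∀ n, 0 ≤ ∑ k ∈ range n, w k := fun n => sum_nonneg (fun k _ => hw k)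
  have hDm : Monotone (fun n => ∑ k ∈ range n, w k) := by
    apply monotone_nat_of_le_succ
    intro n
    rw [sum_range_succ]
    linarith [hw n]
  have hterm : ∀ n, 0 ≤ (∑ k ∈ range n, w k) * (u n - u (n + 1)) := fun n =>
    mul_nonneg (hD n) (sub_nonneg.2 (hu (Nat.le_succ n)))
  have hP : ∀ N, ∑ n ∈ range N, (∑ k ∈ range n, w k) * (u n - u (n + 1))
      = ∑ k ∈ range N, w k * u (k + 1) - (∑ k ∈ range N, w k) * u N := by
    intro N
    induction N with
    | zero => simp
    | succ N ih =>
      rw [sum_range_succ, ih, sum_range_succ (fun k => w k * u (k + 1)), sum_range_succ w]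
      ring
  have hs : Summable (fun n => (∑ k ∈ range n, w k) * (u n - u (n + 1))) := by
    apply summable_of_sum_range_le (c := S) hterm
    intro N
    rw [hP]
    have h1 := h.summable.sum_le_tsum (range N) (fun k _ => mul_nonneg (hw k) (hupos (k + 1)))
    rw [h.tsum_eq] at h1
    have h2 := mul_nonneg (hD N) (hupos N)
    linarith
  obtain ⟨P, hPs⟩ := hs
  have hPt := hPs.tendsto_sum_nat
  have hbound : ∀ N, (∑ k ∈ range N, w k) * u N
      ≤ P - ∑ n ∈ range N, (∑ k ∈ range n, w k) * (u n - u (n + 1)) := by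
    intro N
    have key : ∀ L, (∑ k ∈ range N, w k) * (u N - u (N + L))
      ≤ P - ∑ n ∈ range N, (∑ k ∈ range n, w k) * (u n - u (n + 1)) := by
      intro L
      have h1 : (∑ k ∈ range N, w k) * (u N - u (N + L)) ≤
          ∑ n ∈ range (N + L), (∑ k ∈ range n, w k) * (u n - u (n + 1)) -
          ∑ n ∈ range N, (∑ k ∈ range n, w k) * (u n - u (n + 1)) := by
        induction L with
        | zero => simp
        | succ L ih =>
          rw [← add_assoc, sum_range_succ _ (N + L)]
          have := mul_le_mul_of_nonneg_right (hDm (Nat.le_add_right N L))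
            (sub_nonneg.2 (hu (Nat.le_succ (N + L))))
          simp only [Nat.succ_eq_add_one] at this
          linarith
      have h2 := sum_le_hasSum (range (N + L)) (fun n _ => hterm n) hPs
      linarith
    have ht : Tendsto (fun L => (∑ k ∈ range N, w k) * (u N - u (N + L))) atTop
        (𝓝 ((∑ k ∈ range N, w k) * (u N - 0))) := by
      apply Tendsto.const_mul
      apply Tendsto.const_sub
      have := hu0.comp (tendsto_add_atTop_nat N)
      refine this.congr ?_
      intro L
      simp [add_comm]
    rw [sub_zero] at ht
    exact le_of_tendsto' ht key
  have h0 : Tendsto (fun N => (∑ k ∈ range N, w k) * u N) atTop (𝓝 0) := by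
    refine squeeze_zero (fun N => mul_nonneg (hD N) (hupos N)) hbound ?_
    have := hPt.const_sub P
    simpa using this
  have h3 := h.tendsto_sum_nat.sub h0
  rw [sub_zero] at h3
  have h4 := tendsto_nhds_unique (h3.congr (fun N => (hP N).symm)) hPt
  rw [h4]
  exact hPs

theorem tele_hasSum (u : ℕ → ℝ) (hu : Antitone u) (hu0 : Tendsto u atTop (𝓝 0)) :
    HasSum (fun n => u n - u (n + 1)) (u 0) := by
  rw [hasSum_iff_tendsto_nat_of_nonneg (fun n => sub_nonneg.2 (hu (Nat.le_succ n)))]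
  have := hu0.const_sub (u 0)
  rw [sub_zero] at this
  refine this.congr ?_
  intro n
  rw [sum_range_sub']

/-- connector -/
noncomputable def C (m n : ℕ) : ℝ := (m.factorial * n.factorial : ℝ) / ((m + n).factorial : ℝ)

theorem C_comm (m n : ℕ) : C m n = C n m := by
  unfold C
  rw [add_comm m n, mul_comm]

theorem C_nonneg (m n : ℕ) : 0 ≤ C m n := by unfold C; positivity

theorem C_step (m n : ℕ) : C m (n + 1) = C m n * ((n + 1) / (m + n + 1)) := by
  unfold C
  rw [← add_assoc, Nat.factorial_succ, Nat.factorial_succ]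
  have : ((m + n).factorial : ℝ) ≠ 0 := by positivity
  push_cast
  field_simp

theorem C_anti (m : ℕ) : Antitone (C m) := by
  apply antitone_nat_of_succ_le
  intro n
  rw [C_step]
  apply mul_le_of_le_one_right (C_nonneg m n)
  rw [div_le_one (by positivity)]
  have : (0 : ℝ) ≤ m := by positivity
  linarith

theorem C_diff (m n : ℕ) : C (m + 1) n - C (m + 1) (n + 1)
    = ((m : ℝ) + 1) * (1 / ((n : ℝ) + 1) * C (m + 1) (n + 1)) := by
  rw [C_step]
  push_cast
  field_simp
  ring

theorem C_le (m n : ℕ) : C (m + 1) n ≤ 1 / ((n : ℝ) + 1) := by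
  rw [C_comm]
  refine (C_anti n (show 1 ≤ m + 1 by omega)).trans (le_of_eq ?_)
  rw [C_step n 0]
  simp [C]
  have : (n.factorial : ℝ) ≠ 0 := by positivity
  field_simp

theorem C_tendsto (m : ℕ) : Tendsto (C (m + 1)) atTop (𝓝 0) :=
  squeeze_zero (fun n => C_nonneg _ n) (C_le m) tendsto_one_div_add_atTop_nhds_zero_nat

theorem C_zero (m : ℕ) : C m 0 = 1 := by
  simp [C]
  positivity

theorem conn0 (m : ℕ) : HasSum (fun n : ℕ => 1 / ((n : ℝ) + 1) * C (m + 1) (n + 1))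
    (1 / ((m : ℝ) + 1)) := by
  have h := tele_hasSum _ (C_anti (m + 1)) (C_tendsto m)
  simp_rw [C_diff, C_zero] at h
  have := h.mul_left (1 / ((m : ℝ) + 1))
  refine hs (this) ?_ ?_
  · intro n
    field_simp
  · simp

theorem conn_step (m : ℕ) (w : ℕ → ℝ) (S : ℝ) (hw : ∀ k, 0 ≤ w k)
    (h : HasSum (fun k => w k * C (m + 1) (k + 1)) S) :
    HasSum (fun n : ℕ => (∑ k ∈ range n, w k) / ((n : ℝ) + 1) * C (m + 1) (n + 1))
    (S / ((m : ℝ) + 1)) := by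
  have h := abel_hasSum w _ S hw (C_anti (m + 1)) (C_tendsto m) h
  simp_rw [C_diff] at h
  refine hs (h.div_const ((m : ℝ) + 1)) ?_ rfl
  intro n
  field_simp

/-- `∑_{a<b≤n} 1/(ab)`. -/
noncomputable def F (n : ℕ) : ℝ := ∑ k ∈ range n, harmonicR k / ((k : ℝ) + 1)

theorem H_nonneg (n : ℕ) : 0 ≤ harmonicR n := sum_nonneg (fun k _ => by positivity)
theorem F_nonneg (n : ℕ) : 0 ≤ F n :=
  sum_nonneg (fun k _ => div_nonneg (H_nonneg k) (by positivity))

theorem conn1 (m : ℕ) : HasSum (fun n : ℕ => harmonicR n / ((n : ℝ) + 1) * C (m + 1) (n + 1))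
    (1 / ((m : ℝ) + 1) ^ 2) := by
  refine hs (conn_step m (fun k => 1 / ((k : ℝ) + 1)) _ (fun k => by positivity) (conn0 m)) (fun _ => rfl) ?_
  field_simp

theorem conn2 (m : ℕ) : HasSum (fun n : ℕ => F n / ((n : ℝ) + 1) * C (m + 1) (n + 1))
    (1 / ((m : ℝ) + 1) ^ 3) := by
  refine hs (conn_step m (fun k => harmonicR k / ((k : ℝ) + 1)) _
    (fun k => div_nonneg (H_nonneg k) (by positivity)) (conn1 m)) (fun _ => rfl) ?_
  field_simp

theorem swap_hasSum (f : ℕ × ℕ → ℝ) (hf : ∀ p, 0 ≤ f p) (a b : ℕ → ℝ) (S : ℝ)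
    (ha : ∀ i, HasSum (fun j => f (i, j)) (a i)) (hb : ∀ j, HasSum (fun i => f (i, j)) (b j))
    (hS : HasSum a S) : HasSum b S := by
  have hs : Summable f := by
    rw [summable_prod_of_nonneg hf]
    refine ⟨fun i => (ha i).summable, ?_⟩
    simp_rw [(ha _).tsum_eq]
    exact hS.summable
  have h1 := hs.hasSum
  have h2 := (h1.prod_fiberwise ha).unique hS
  rw [h2] at h1
  have h3 := (Equiv.prodComm ℕ ℕ).hasSum_iff.2 h1
  exact h3.prod_fiberwise hb

theorem duality (S : ℝ) (h : HasSum (fun n : ℕ => harmonicR n / ((n : ℝ) + 1) ^ 4) S) :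
    HasSum (fun n : ℕ => F n / ((n : ℝ) + 1) ^ 3) S := by
  refine swap_hasSum
    (fun p => (harmonicR p.1 / ((p.1 : ℝ) + 1)) * (F p.2 / ((p.2 : ℝ) + 1)) * C (p.1 + 1) (p.2 + 1))
    ?_ _ _ S ?_ ?_ h
  · intro p
    have := H_nonneg p.1
    have := F_nonneg p.2
    have := C_nonneg (p.1 + 1) (p.2 + 1)
    positivity
  · intro i
    refine hs ((conn2 i).mul_left (harmonicR i / ((i : ℝ) + 1))) ?_ ?_
    · intro j
      ring
    · field_simp
  · intro j
    refine hs ((conn1 j).mul_left (F j / ((j : ℝ) + 1))) ?_ ?_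
    · intro i
      dsimp only
      rw [C_comm]
      ring
    · field_simp

theorem H_sq (n : ℕ) : harmonicR n ^ 2 = 2 * F n + ∑ k ∈ range n, 1 / ((k : ℝ) + 1) ^ 2 := by
  induction n with
  | zero => simp [harmonicR, F]
  | succ n ih =>
    have h1 : harmonicR (n + 1) = harmonicR n + 1 / ((n : ℝ) + 1) := by
      simp [harmonicR, sum_range_succ]
    have h2 : F (n + 1) = F n + harmonicR n / ((n : ℝ) + 1) := by
      simp [F, sum_range_succ]
    rw [h1, h2, sum_range_succ]
    have : (harmonicR n + 1 / ((n : ℝ) + 1)) ^ 2 = harmonicR n ^ 2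
      + 2 * (harmonicR n / ((n : ℝ) + 1)) + 1 / ((n : ℝ) + 1) ^ 2 := by
      field_simp
      ring
    rw [this, ih]
    ring

theorem diag_hasSum (f g : ℕ → ℝ) (S : ℝ)
    (h : HasSum (fun p : ℕ × ℕ => f p.1 * g (p.1 + p.2 + 1)) S) :
    HasSum (fun n => (∑ k ∈ range n, f k) * g n) S := by
  rw [← hasSum_nat_add_iff' 1]
  simp only [range_one, sum_singleton, range_zero, sum_empty, zero_mul, sub_zero]
  have h1 := (Finset.HasAntidiagonal.sigmaAntidiagonalEquivProd (A := ℕ)).hasSum_iff.2 h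
  have h2 := h1.sigma (fun n => hasSum_fintype _)
  refine hs (h2) ?_ rfl
  intro n
  rw [sum_mul]
  simp only [Function.comp, Finset.HasAntidiagonal.sigmaAntidiagonalEquivProd_apply]
  rw [Finset.sum_coe_sort (antidiagonal n) (fun p => f p.1 * g (p.1 + p.2 + 1)),
    Finset.Nat.sum_antidiagonal_eq_sum_range_succ_mk]
  apply sum_congr rfl
  intro k hk
  have : k ≤ n := by
    have := mem_range.1 hk
    omega
  simp only
  rw [Nat.add_sub_cancel' this]

theorem stuffle (a b : ℕ → ℝ) (A B : ℝ) (ha0 : ∀ n, 0 ≤ a n) (hb0 : ∀ n, 0 ≤ b n)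
    (ha : HasSum a A) (hb : HasSum b B) :
    HasSum (fun n => (∑ k ∈ range n, a k) * b n + (∑ k ∈ range n, b k) * a n + a n * b n)
      (A * B) := by
  rw [hasSum_iff_tendsto_nat_of_nonneg]
  · refine (ha.tendsto_sum_nat.mul hb.tendsto_sum_nat).congr ?_
    intro n
    induction n with
    | zero => simp
    | succ n ih =>
      rw [sum_range_succ (fun n => (∑ k ∈ range n, a k) * b n + (∑ k ∈ range n, b k) * a n + a n * b n),
        ← ih, sum_range_succ a, sum_range_succ b]
      ring
  · intro n
    have := ha0 n
    have := hb0 n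
    have := sum_nonneg (s := range n) (fun k _ => ha0 k)
    have := sum_nonneg (s := range n) (fun k _ => hb0 k)
    positivity

theorem inner_hasSum (x : ℕ) :
    HasSum (fun y : ℕ => 1 / ((y : ℝ) + 1) - 1 / ((x : ℝ) + y + 1)) (harmonicR x) := by
  induction x with
  | zero => simp [harmonicR]
  | succ x ih =>
    have hu : Antitone (fun y : ℕ => 1 / ((x : ℝ) + y + 1)) := by
      intro a b hab
      dsimp only
      gcongr
    have ht : Tendsto (fun y : ℕ => 1 / ((x : ℝ) + y + 1)) atTop (𝓝 0) := by
      have := (tendsto_one_div_add_atTop_nhds_zero_nat (𝕜 := ℝ)).comp (tendsto_add_atTop_nat x)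
      refine this.congr ?_
      intro y
      simp [add_comm]
    have h := ih.add (tele_hasSum _ hu ht)
    refine hs (h) ?_ ?_
    · intro y
      push_cast
      ring
    · simp [harmonicR, sum_range_succ]

theorem zeta_hasSum (k : ℕ) (hk : 2 ≤ k) :
    HasSum (fun n : ℕ => 1 / ((n : ℝ) + 1) ^ k) (zetaR k) := by
  have h1 : Summable (fun n : ℕ => 1 / ((n : ℝ) + 1) ^ k) := by
    have := (summable_nat_add_iff 1).2 (Real.summable_one_div_nat_pow.2 (show 1 < k by omega))
    simpa using this
  convert h1.hasSum using 1
  unfold zetaR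
  simp_rw [Real.rpow_natCast]

/-- Summand of the double zeta value, `1/(x^t (x+y)^s)`. -/
noncomputable def e (s t : ℕ) (p : ℕ × ℕ) : ℝ :=
  1 / ((p.1 : ℝ) + 1) ^ t * (1 / (((p.1 + p.2 + 1 : ℕ) : ℝ) + 1) ^ s)

theorem he (s t : ℕ) (p : ℕ × ℕ) : 0 ≤ e s t p := by
  unfold e
  positivity

theorem shuf (p : ℕ × ℕ) : 1 / ((p.1 : ℝ) + 1) ^ 2 * (1 / ((p.2 : ℝ) + 1) ^ 3) =
    3 * e 4 1 p + e 3 2 p + 3 * e 4 1 p.swap + 2 * e 3 2 p.swap + e 2 3 p.swap := by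
  obtain ⟨a, b⟩ := p
  simp only [e, Prod.swap]
  push_cast
  have h3 : (b : ℝ) + a + 1 + 1 = a + b + 1 + 1 := by ring
  rw [h3]
  have h1 : (a : ℝ) + b + 1 + 1 ≠ 0 := by positivity
  field_simp
  ring

theorem sumf (a b : ℕ) : e 4 1 (a, b) + e 3 2 (a, b) + e 2 3 (a, b) + e 4 1 (b, a) =
    1 / ((a : ℝ) + 1) ^ 4 * (1 / ((b : ℝ) + 1) - 1 / (((a + 1 : ℕ) : ℝ) + b + 1)) := by
  simp only [e]
  push_cast
  have h1 : (a : ℝ) + b + 1 + 1 ≠ 0 := by positivity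
  have h3 : (b : ℝ) + a + 1 + 1 = a + b + 1 + 1 := by ring
  have h4 : (a : ℝ) + 1 + b + 1 = a + b + 1 + 1 := by ring
  rw [h3, h4]
  field_simp
  ring

end EulerAux

set_option maxHeartbeats 4000000 in
open EulerAux in
/-- Euler sum: `∑_{m≥1} H_{m-1}²/m³ = ζ(2)ζ(3) − (3/2)ζ(5)`. -/
theorem stmt4 :
    HasSum (fun m : ℕ => harmonicR m ^ 2 / ((m : ℝ) + 1) ^ 3)
      (zetaR 2 * zetaR 3 - (3 / 2) * zetaR 5) := by
  have z2 : HasSum (fun n : ℕ => 1 / ((n : ℝ) + 1) ^ 2) (zetaR 2) := by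
    simpa only [Nat.cast_ofNat] using zeta_hasSum 2 (by norm_num)
  have z3 : HasSum (fun n : ℕ => 1 / ((n : ℝ) + 1) ^ 3) (zetaR 3) := by
    simpa only [Nat.cast_ofNat] using zeta_hasSum 3 (by norm_num)
  have z5 : HasSum (fun n : ℕ => 1 / ((n : ℝ) + 1) ^ 5) (zetaR 5) := by
    simpa only [Nat.cast_ofNat] using zeta_hasSum 5 (by norm_num)
  have prod : HasSum (fun p : ℕ × ℕ => 1 / ((p.1 : ℝ) + 1) ^ 2 * (1 / ((p.2 : ℝ) + 1) ^ 3))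
      (zetaR 2 * zetaR 3) :=
    z2.mul z3 (z2.summable.mul_of_nonneg z3.summable (fun n => by positivity)
      (fun n => by positivity))
  have s41 : Summable (e 4 1) := by
    refine Summable.of_nonneg_of_le (he 4 1) (fun p => ?_) prod.summable
    rw [shuf]
    linarith [he 4 1 p, he 3 2 p, he 4 1 p.swap, he 3 2 p.swap, he 2 3 p.swap]
  have s32 : Summable (e 3 2) := by
    refine Summable.of_nonneg_of_le (he 3 2) (fun p => ?_) prod.summable
    rw [shuf]
    linarith [he 4 1 p, he 3 2 p, he 4 1 p.swap, he 3 2 p.swap, he 2 3 p.swap]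
  have s23' : Summable (fun p : ℕ × ℕ => e 2 3 p.swap) := by
    refine Summable.of_nonneg_of_le (fun p => he 2 3 _) (fun p => ?_) prod.summable
    rw [shuf]
    linarith [he 4 1 p, he 3 2 p, he 4 1 p.swap, he 3 2 p.swap, he 2 3 p.swap]
  have s23 : Summable (e 2 3) := (Equiv.prodComm ℕ ℕ).summable_iff.1 s23'
  obtain ⟨E41, h41⟩ := s41
  obtain ⟨E32, h32⟩ := s32
  obtain ⟨E23, h23⟩ := s23
  have h41' : HasSum (fun p : ℕ × ℕ => e 4 1 p.swap) E41 := (Equiv.prodComm ℕ ℕ).hasSum_iff.2 h41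
  have h32' : HasSum (fun p : ℕ × ℕ => e 3 2 p.swap) E32 := (Equiv.prodComm ℕ ℕ).hasSum_iff.2 h32
  have h23' : HasSum (fun p : ℕ × ℕ => e 2 3 p.swap) E23 := (Equiv.prodComm ℕ ℕ).hasSum_iff.2 h23
  have eq1 : zetaR 2 * zetaR 3 = 3 * E41 + E32 + 3 * E41 + 2 * E32 + E23 := by
    refine prod.unique ?_
    simp_rw [shuf]
    exact ((((h41.mul_left 3).add h32).add (h41'.mul_left 3)).add (h32'.mul_left 2)).add h23'
  have d41 := diag_hasSum (fun k => 1 / ((k : ℝ) + 1) ^ 1) (fun n => 1 / ((n : ℝ) + 1) ^ 4) E41 h41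
  have d32 := diag_hasSum (fun k => 1 / ((k : ℝ) + 1) ^ 2) (fun n => 1 / ((n : ℝ) + 1) ^ 3) E32 h32
  have d23 := diag_hasSum (fun k => 1 / ((k : ℝ) + 1) ^ 3) (fun n => 1 / ((n : ℝ) + 1) ^ 2) E23 h23
  have eq2 : zetaR 2 * zetaR 3 = E32 + E23 + zetaR 5 := by
    refine (stuffle _ _ _ _ (fun n => by positivity) (fun n => by positivity) z2 z3).unique ?_
    refine hs ((d32.add d23).add z5) ?_ rfl
    intro n
    congr 1
    field_simp
  have hH4 : HasSum (fun n : ℕ => harmonicR n / ((n : ℝ) + 1) ^ 4) E41 := by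
    refine hs (d41) ?_ rfl
    intro n
    simp [harmonicR, div_eq_mul_inv]
  have eq3 : E41 + E32 + E23 + E41 = E41 + zetaR 5 := by
    have hG := ((h41.add h32).add h23).add h41'
    have hfib := hG.prod_fiberwise (g := fun a : ℕ => harmonicR a / ((a : ℝ) + 1) ^ 4 +
      1 / ((a : ℝ) + 1) ^ 5) (by
        intro a
        have h := (inner_hasSum (a + 1)).mul_left (1 / ((a : ℝ) + 1) ^ 4)
        refine hs (h) ?_ ?_
        · intro b
          exact sumf a b
        · have h1 : harmonicR (a + 1) = harmonicR a + 1 / ((a : ℝ) + 1) := by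
            simp [harmonicR, sum_range_succ]
          rw [h1]
          field_simp)
    exact hfib.unique (hH4.add z5)
  have hF := duality E41 hH4
  have hfin := (hF.mul_left 2).add d32
  refine hs (hfin) ?_ ?_
  · intro n
    rw [H_sq]
    ring
  · linarith
end

section
/- Let β be a real number with 1 < β < 2 and set 𝒰₀ := 4 ζ(β) + 2^{β+2} + 2^{β+2}/β. Then for every integer m ≥ 1, ∑_{ℓ ∈ ℤ, ℓ ≠ 0, ℓ ≠ m} 1/(|ℓ| · |m − ℓ|^{β}) ≤ 𝒰₀ · (1 + log m)/m. -/
lemma aux_hasSum (β : ℝ) (hβ1 : 1 < β) :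
    HasSum (fun ℓ : ℤ => 1 / |(ℓ : ℝ)| ^ β) (2 * zetaR β) := by
  have hs : Summable (fun n : ℕ => 1 / ((n : ℝ)) ^ β) :=
    Real.summable_one_div_nat_rpow.mpr hβ1
  have hs1 : HasSum (fun n : ℕ => 1 / ((n : ℝ) + 1) ^ β) (zetaR β) := by
    have := (summable_nat_add_iff 1).mpr hs
    push_cast at this
    unfold zetaR
    exact this.hasSum
  have hs0 : HasSum (fun n : ℕ => 1 / |((n : ℤ) : ℝ)| ^ β) (zetaR β) := by
    have e : (1 : ℝ) / |(((0 : ℕ) : ℤ) : ℝ)| ^ β = 0 := by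
      simp [Real.zero_rpow (by linarith : β ≠ 0)]
    have e2 : (fun n : ℕ => 1 / |(((n + 1 : ℕ) : ℤ) : ℝ)| ^ β)
        = fun n : ℕ => 1 / ((n : ℝ) + 1) ^ β := by
      funext n
      have h : (0 : ℝ) ≤ (n : ℝ) + 1 := by positivity
      push_cast
      rw [abs_of_nonneg h]
    have h1 := hs1
    rw [← e2] at h1
    have h2 := HasSum.zero_add (f := fun n : ℕ => 1 / |((n : ℤ) : ℝ)| ^ β) h1
    simp only [e, zero_add] at h2
    exact h2
  have hs2 : HasSum (fun n : ℕ => 1 / |((-((n : ℤ) + 1) : ℤ) : ℝ)| ^ β) (zetaR β) := by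
    have e2 : (fun n : ℕ => 1 / |((-((n : ℤ) + 1) : ℤ) : ℝ)| ^ β)
        = fun n : ℕ => 1 / ((n : ℝ) + 1) ^ β := by
      funext n
      have h : (0 : ℝ) ≤ (n : ℝ) + 1 := by positivity
      push_cast
      rw [abs_neg, abs_of_nonneg h]
    rw [e2]
    exact hs1
  have := HasSum.of_nat_of_neg_add_one (f := fun ℓ : ℤ => 1 / |(ℓ : ℝ)| ^ β) hs0 hs2
  rwa [← two_mul] at this

lemma aux_young (β : ℝ) (hβ1 : 1 < β) (m a b : ℝ) (hm : 0 < m) (ha : 0 < a) (hb : 0 < b)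
    (h : m ≤ a + b) :
    1 / (a * b ^ β) ≤ ((1 / β) * (1 / a ^ β) + (2 - 1 / β) * (1 / b ^ β)) / m := by
  have hβ : 0 < β := by linarith
  have key := Real.geom_mean_le_arith_mean2_weighted (w₁ := 1 / β) (w₂ := 1 - 1 / β)
    (p₁ := a ^ (-β)) (p₂ := b ^ (-β)) (by positivity)
    (by rw [sub_nonneg, div_le_one hβ]; exact hβ1.le) (by positivity) (by positivity) (by ring)
  rw [← Real.rpow_mul ha.le, ← Real.rpow_mul hb.le,
    show -β * (1 / β) = -1 by field_simp, show -β * (1 - 1 / β) = 1 - β by field_simp; ring,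
    Real.rpow_neg_one, Real.rpow_sub hb, Real.rpow_one, Real.rpow_neg ha.le,
    Real.rpow_neg hb.le] at key
  have hbp : 0 < b ^ β := by positivity
  rw [le_div_iff₀ hm]
  calc 1 / (a * b ^ β) * m ≤ 1 / (a * b ^ β) * (a + b) := by gcongr
    _ = 1 / b ^ β + a⁻¹ * (b / b ^ β) := by field_simp
    _ ≤ _ := by
      simp only [one_div] at key ⊢
      linarith

/-- A harmonic-weighted kernel bound: for `1 < β < 2`, with
`𝒰₀ = 4ζ(β) + 2^{β+2} + 2^{β+2}/β`, for every integer `m ≥ 1`,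
`∑_{ℓ≠0, ℓ≠m} 1/(|ℓ| |m−ℓ|^β) ≤ 𝒰₀ (1+log m)/m`. -/
theorem stmt11 (β : ℝ) (hβ1 : 1 < β) (hβ2 : β < 2) (m : ℕ) (hm : 1 ≤ m) :
    Summable (fun ℓ : {ℓ : ℤ // ℓ ≠ 0 ∧ ℓ ≠ (m : ℤ)} =>
        1 / (|(ℓ.1 : ℝ)| * |(m : ℝ) - (ℓ.1 : ℝ)| ^ β)) ∧
      ∑' ℓ : {ℓ : ℤ // ℓ ≠ 0 ∧ ℓ ≠ (m : ℤ)},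
          1 / (|(ℓ.1 : ℝ)| * |(m : ℝ) - (ℓ.1 : ℝ)| ^ β)
        ≤ (4 * zetaR β + (2 : ℝ) ^ (β + 2) + (2 : ℝ) ^ (β + 2) / β) *
            (1 + Real.log m) / m := by
  have hm0 : (0 : ℝ) < m := by exact_mod_cast hm
  have hβ : 0 < β := by linarith
  have hA := aux_hasSum β hβ1
  have hB : HasSum (fun ℓ : ℤ => 1 / |(m : ℝ) - (ℓ : ℝ)| ^ β) (2 * zetaR β) := by
    have := (Equiv.hasSum_iff (Equiv.subLeft (m : ℤ))).mpr hA
    simpa [Function.comp_def] using this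
  have hG := ((hA.mul_left (1 / β)).add (hB.mul_left (2 - 1 / β))).div_const (m : ℝ)
  have hinv : 1 / β ≤ 1 := by rw [div_le_one hβ]; exact hβ1.le
  have h2 : 0 ≤ 2 - 1 / β := by linarith
  set G : ℤ → ℝ := fun ℓ : ℤ => ((1 / β) * (1 / |(ℓ : ℝ)| ^ β)
    + (2 - 1 / β) * (1 / |(m : ℝ) - (ℓ : ℝ)| ^ β)) / (m : ℝ) with hGdef
  have hG0 : ∀ ℓ, 0 ≤ G ℓ := fun ℓ => by
    simp only [hGdef]
    positivity
  have hle : ∀ ℓ : {ℓ : ℤ // ℓ ≠ 0 ∧ ℓ ≠ (m : ℤ)},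
      1 / (|(ℓ.1 : ℝ)| * |(m : ℝ) - (ℓ.1 : ℝ)| ^ β) ≤ G ℓ.1 := by
    rintro ⟨ℓ, h0, h1⟩
    apply aux_young β hβ1 _ _ _ hm0
    · exact abs_pos.mpr (by exact_mod_cast h0)
    · exact abs_pos.mpr (sub_ne_zero.mpr (by exact_mod_cast h1.symm))
    · have e1 := le_abs_self (ℓ : ℝ)
      have e2 := le_abs_self ((m : ℝ) - (ℓ : ℝ))
      linarith
  have hGs : Summable (fun ℓ : {ℓ : ℤ // ℓ ≠ 0 ∧ ℓ ≠ (m : ℤ)} => G ℓ.1) :=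
    hG.summable.comp_injective Subtype.val_injective
  have hS := Summable.of_nonneg_of_le (fun ℓ => by positivity) hle hGs
  refine ⟨hS, (hS.tsum_le_tsum hle hGs).trans ?_⟩
  have h3 : ∑' ℓ : {ℓ : ℤ // ℓ ≠ 0 ∧ ℓ ≠ (m : ℤ)}, G ℓ.1 ≤ ∑' ℓ, G ℓ :=
    hG.summable.tsum_subtype_le G {ℓ : ℤ | ℓ ≠ 0 ∧ ℓ ≠ (m : ℤ)} hG0
  refine h3.trans ?_
  rw [hG.tsum_eq]
  have hz : 0 ≤ zetaR β := tsum_nonneg fun n => by positivity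
  have hlog : 0 ≤ Real.log m := Real.log_natCast_nonneg m
  have hp : 0 ≤ (2 : ℝ) ^ (β + 2) := by positivity
  have hq : 0 ≤ (2 : ℝ) ^ (β + 2) / β := by positivity
  gcongr
  have : 0 ≤ (4 * zetaR β + (2 : ℝ) ^ (β + 2) + (2 : ℝ) ^ (β + 2) / β) * Real.log m := by
    positivity
  linarith
end
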